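/- Let n ≥ 3 be odd, let nᵢ = (cos(2πi/n), sin(2πi/n)) for i = 1,…,n, and let αᵢ = 1/n. Then the inradius of the compatible region m = {2·Σᵢ qᵢ αᵢ nᵢ : 0 ≤ qᵢ ≤ 1, Σᵢ qᵢ αᵢ = 1/2} ⊆ ℝ² equals (1/n)·cot(π/(2n))·cos(π/(2n)): the closed ball of this radius centered at the origin is contained in m, and no closed ball of larger radius centered at the origin is contained in m. -/

import Mathlib

open Real

/-- The compatible region of a `k`-outcome POVM with rank-one effect directions
`n i` and weights `α i`. -/
def compatRegion {d k : ℕ} (α : Fin k → ℝ) (n : Fin k → EuclideanSpace ℝ (Fin d)) :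
    Set (EuclideanSpace ℝ (Fin d)) :=
  {x | ∃ q : Fin k → ℝ, (∀ i, 0 ≤ q i ∧ q i ≤ 1) ∧
    (∑ i, q i * α i = 1 / 2) ∧ x = ∑ i, (2 * (q i * α i)) • n i}

/-- The rotationally symmetric configuration `nᵢ = (cos(2πi/n), sin(2πi/n))` in `ℝ²`. -/
noncomputable def rotVec (n : ℕ) : Fin n → EuclideanSpace ℝ (Fin 2) := fun i =>
  (WithLp.equiv 2 (Fin 2 → ℝ)).symm
    ![Real.cos (2 * π * (i.1 + 1) / n), Real.sin (2 * π * (i.1 + 1) / n)]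

lemma rp_sum_cos (x b : ℝ) (m : ℕ) :
    (∑ j ∈ Finset.range m, cos (x + 2 * j * b)) * (2 * sin b) =
      sin (x + (2 * m - 1) * b) - sin (x - b) := by
  induction m with
  | zero => simp; try ring_nf
  | succ k ih =>
    rw [Finset.sum_range_succ, add_mul, ih]
    have h1 : x + (2 * ((k + 1 : ℕ) : ℝ) - 1) * b = (x + 2 * k * b) + b := by push_cast; ring
    have h2 : x + (2 * (k : ℝ) - 1) * b = (x + 2 * k * b) - b := by ring
    rw [h1, h2, sin_add, sin_sub (x + 2 * k * b)]
    ring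

lemma rp_sum_shift (n : ℕ) (F : ℕ → ℝ) (hF : ∀ j, F (j + n) = F j) (k : ℕ) :
    ∑ i ∈ Finset.range n, F (i + k) = ∑ i ∈ Finset.range n, F i := by
  induction k with
  | zero => simp
  | succ k ih =>
    rw [← ih]
    have h1 := Finset.sum_range_succ (fun i => F (i + k)) n
    have h2 := Finset.sum_range_succ' (fun i => F (i + k)) n
    have h3 : F (n + k) = F k := by rw [add_comm, hF]
    simp only [zero_add, h3] at h1 h2
    have h4 : ∑ i ∈ Finset.range n, F (i + (k + 1)) = ∑ i ∈ Finset.range n, F (i + 1 + k) :=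
      Finset.sum_congr rfl fun i _ => by congr 1; ring
    rw [h4]; linarith

/-- vertex weight -/
noncomputable def rpf (m : ℕ) (j : ℕ) : ℝ :=
  if j % (2 * m + 1) < m then 1 else if j % (2 * m + 1) = m then 1 / 2 else 0

lemma rpf_mem (m j : ℕ) : 0 ≤ rpf m j ∧ rpf m j ≤ 1 := by
  unfold rpf; split_ifs <;> norm_num

lemma rpf_per (m j : ℕ) : rpf m (j + (2 * m + 1)) = rpf m j := by
  unfold rpf; simp

lemma rpf_sum (m : ℕ) (g : ℕ → ℝ) :
    ∑ j ∈ Finset.range (2 * m + 1), rpf m j * g j =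
      ∑ j ∈ Finset.range m, g j + 1 / 2 * g m := by
  have h : 2 * m + 1 = (m + 1) + m := by ring
  have e : ∑ j ∈ Finset.range (2 * m + 1), rpf m j * g j =
    ∑ j ∈ Finset.range (2 * m + 1), (if j < m then 1 else if j = m then 1 / 2 else 0) * g j := by
    refine Finset.sum_congr rfl fun j hj => ?_
    rw [rpf, Nat.mod_eq_of_lt (Finset.mem_range.1 hj)]
  rw [e, h, Finset.sum_range_add, Finset.sum_range_succ]
  have h0 : ∑ x ∈ Finset.range m, (if m + 1 + x < m then (1 : ℝ) else
      if m + 1 + x = m then 1 / 2 else 0) * g (m + 1 + x) = 0 := by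
    refine Finset.sum_eq_zero fun x _ => ?_
    rw [if_neg (by omega), if_neg (by omega), zero_mul]
  rw [h0]
  simp only [lt_irrefl, if_false, if_true, add_zero]
  congr 1
  refine Finset.sum_congr rfl fun x hx => ?_
  rw [if_pos (Finset.mem_range.1 hx), one_mul]

lemma rp_full_sum (m : ℕ) (hm : 1 ≤ m) (x : ℝ) :
    ∑ j ∈ Finset.range (2 * m + 1), cos (x + 2 * j * (π / (2 * m + 1))) = 0 := by
  have hb : 0 < sin (π / (2 * m + 1)) := by
    apply sin_pos_of_pos_of_lt_pi (by positivity)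
    apply div_lt_self pi_pos
    have : (1 : ℝ) ≤ m := by exact_mod_cast hm
    linarith
  have h := rp_sum_cos x (π / (2 * m + 1)) (2 * m + 1)
  have e : x + (2 * ((2 * m + 1 : ℕ) : ℝ) - 1) * (π / (2 * m + 1)) =
      (x - π / (2 * m + 1)) + 2 * π := by
    push_cast; field_simp; ring
  rw [e, sin_add_two_pi, sub_self] at h
  rcases mul_eq_zero.1 h with h | h
  · exact h
  · linarith

lemma rp_vertex (m : ℕ) (hm : 1 ≤ m) (a ψ : ℝ) (ha : a = π / (2 * (2 * m + 1))) :
    ∑ j ∈ Finset.range (2 * m + 1), rpf m j * cos (2 * π * (j + 1) / (2 * m + 1) - ψ) =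
      1 / 2 * (cos a / sin a) * cos (ψ - (π / 2 + 2 * a)) := by
  have hm' : (1 : ℝ) ≤ m := by exact_mod_cast hm
  have ha0 : 0 < a := by rw [ha]; positivity
  have ha1 : a < π / 2 := by
    rw [ha]; apply div_lt_div_of_pos_left pi_pos <;> linarith
  have hs : 0 < sin a := sin_pos_of_pos_of_lt_pi ha0 (by linarith [pi_pos])
  have hc : 0 < cos a := cos_pos_of_mem_Ioo ⟨by linarith, ha1⟩
  have hma : 2 * m * (2 * a) = π - 2 * a := by rw [ha]; field_simp; ring
  rw [rpf_sum]
  have e : ∀ j : ℕ, 2 * π * (j + 1) / (2 * m + 1) - ψ = (2 * (2 * a) - ψ) + 2 * j * (2 * a) := by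
    intro j; rw [ha]; field_simp; ring
  simp only [e]
  have h := rp_sum_cos (2 * (2 * a) - ψ) (2 * a) m
  have e1 : 2 * (2 * a) - ψ + (2 * (m : ℝ) - 1) * (2 * a) = π - ψ := by linarith
  have e2 : 2 * (2 * a) - ψ - 2 * a = 2 * a - ψ := by ring
  have e3 : 2 * (2 * a) - ψ + 2 * m * (2 * a) = π - (ψ - 2 * a) := by linarith
  have e4 : ψ - (π / 2 + 2 * a) = (ψ - 2 * a) - π / 2 := by ring
  rw [e1, e2, sin_pi_sub] at h
  rw [e3, e4, cos_pi_sub, cos_sub_pi_div_two]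
  have hS : ∑ j ∈ Finset.range m, cos (2 * (2 * a) - ψ + 2 * j * (2 * a)) =
      (sin ψ - sin (2 * a - ψ)) / (2 * sin (2 * a)) := by
    rw [eq_div_iff, h]
    rw [sin_two_mul]; positivity
  rw [hS]
  have e5 : sin ψ = sin ((ψ - 2 * a) + 2 * a) := by ring_nf
  have e6 : sin (2 * a - ψ) = - sin (ψ - 2 * a) := by rw [← sin_neg]; ring_nf
  rw [e5, e6, sin_add, sin_two_mul, cos_two_mul]
  field_simp
  ring

lemma rp_choose (m : ℕ) (a θ ψ : ℝ) (ha : a = π / (2 * (2 * m + 1))) (ha1 : a < π / 2) :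
    ∃ k : ℕ, cos a ≤ |cos (θ + 2 * π * k / (2 * m + 1) - ψ)| := by
  have ha0 : 0 < a := by rw [ha]; positivity
  have hp := pi_pos
  obtain ⟨j, hj⟩ : ∃ j : ℤ, |θ + j * (2 * a) - ψ| ≤ a := by
    refine ⟨round ((ψ - θ) / (2 * a)), ?_⟩
    have h := abs_sub_round ((ψ - θ) / (2 * a))
    have : θ + (round ((ψ - θ) / (2 * a))) * (2 * a) - ψ =
      - (((ψ - θ) / (2 * a) - round ((ψ - θ) / (2 * a))) * (2 * a)) := by
        field_simp; ring
    rw [this, abs_neg, abs_mul, abs_of_pos (show 0 < 2 * a by linarith)]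
    nlinarith
  have hcos : cos a ≤ cos (θ + j * (2 * a) - ψ) := by
    rw [← cos_abs (θ + j * (2 * a) - ψ)]
    exact cos_le_cos_of_nonneg_of_le_pi (abs_nonneg _) (by linarith) hj
  have hπ : π = (2 * m + 1) * (2 * a) := by rw [ha]; field_simp
  obtain ⟨k, hk⟩ : ∃ k : ℤ, cos a ≤ |cos (θ + 2 * k * (2 * a) - ψ)| := by
    rcases Int.even_or_odd' j with ⟨k, rfl | rfl⟩
    · exact ⟨k, le_trans (by push_cast at hcos; exact hcos) (le_abs_self _)⟩
    · refine ⟨k + m + 1, ?_⟩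
      have : θ + 2 * ((k + m + 1 : ℤ) : ℝ) * (2 * a) - ψ
        = (θ + ((2 * k + 1 : ℤ) : ℝ) * (2 * a) - ψ) + π := by
        rw [hπ]; push_cast; ring
      rw [this, cos_add_pi, abs_neg]
      exact hcos.trans (le_abs_self _)
  obtain ⟨l, hl⟩ : ∃ l : ℕ, (l : ℤ) = k + |k| * (2 * m + 1) := by
    refine Int.eq_ofNat_of_zero_le ?_ |>.imp fun _ h => h.symm
    nlinarith [neg_abs_le k, abs_nonneg k, Int.natCast_nonneg m,
      mul_nonneg (abs_nonneg k) (Int.natCast_nonneg m)]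
  refine ⟨l, ?_⟩
  have hl' : (l : ℝ) = k + ((|k| : ℤ) : ℝ) * (2 * m + 1) := by
    have := congrArg (Int.cast : ℤ → ℝ) hl
    push_cast at this ⊢; exact this
  have : θ + 2 * π * l / (2 * m + 1) - ψ = (θ + 2 * k * (2 * a) - ψ) + (|k| : ℤ) * (2 * π) := by
    rw [hl', ha]; field_simp; ring
  rw [this, cos_add_int_mul_two_pi]
  exact hk

lemma rp_support (m : ℕ) (hm : 1 ≤ m) (a θ : ℝ) (ha : a = π / (2 * (2 * m + 1))) :
    ∃ q : ℕ → ℝ, (∀ i, 0 ≤ q i ∧ q i ≤ 1) ∧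
      ∑ i ∈ Finset.range (2 * m + 1), q i = (2 * m + 1) / 2 ∧
      1 / 2 * (cos a / sin a) * cos a ≤
        ∑ i ∈ Finset.range (2 * m + 1), q i * cos (2 * π * (i + 1) / (2 * m + 1) - θ) := by
  have hm' : (1 : ℝ) ≤ m := by exact_mod_cast hm
  have ha0 : 0 < a := by rw [ha]; positivity
  have ha1 : a < π / 2 := by
    rw [ha]; apply div_lt_div_of_pos_left pi_pos <;> linarith
  have hs : 0 < sin a := sin_pos_of_pos_of_lt_pi ha0 (by linarith [pi_pos])
  have hc : 0 < cos a := cos_pos_of_mem_Ioo ⟨by linarith, ha1⟩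
  obtain ⟨k, hk⟩ := rp_choose m a θ (π / 2 + 2 * a) ha ha1
  have hsum : ∑ i ∈ Finset.range (2 * m + 1), rpf m (i + k) = (2 * m + 1) / 2 := by
    rw [rp_sum_shift (2 * m + 1) (rpf m) (rpf_per m) k]
    have := rpf_sum m (fun _ => 1)
    simp at this
    rw [this]; ring
  have hV : ∑ i ∈ Finset.range (2 * m + 1), rpf m (i + k) *
      cos (2 * π * (i + 1) / (2 * m + 1) - θ) = 1 / 2 * (cos a / sin a) *
        cos (θ + 2 * π * k / (2 * m + 1) - (π / 2 + 2 * a)) := by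
    rw [← rp_vertex m hm a _ ha]
    rw [← rp_sum_shift (2 * m + 1) (fun j => rpf m j *
      cos (2 * π * (j + 1) / (2 * m + 1) - (θ + 2 * π * k / (2 * m + 1)))) _ k]
    · refine Finset.sum_congr rfl fun i _ => ?_
      congr 2
      push_cast; field_simp; ring
    · intro j
      simp only [rpf_per]
      congr 1
      rw [← cos_add_two_pi (2 * π * (j + 1) / (2 * m + 1) - _)]
      congr 1
      push_cast; field_simp; ring
  have hz : ∑ i ∈ Finset.range (2 * m + 1), cos (2 * π * (i + 1) / (2 * m + 1) - θ) = 0 := by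
    rw [← rp_full_sum m hm (2 * π / (2 * m + 1) - θ)]
    refine Finset.sum_congr rfl fun i _ => ?_
    congr 1; field_simp; ring
  have hpos : 0 ≤ 1 / 2 * (cos a / sin a) := by positivity
  rcases le_abs.1 hk with h | h
  · exact ⟨fun i => rpf m (i + k), fun i => rpf_mem _ _, hsum, by
      rw [hV]; exact mul_le_mul_of_nonneg_left h hpos⟩
  · refine ⟨fun i => 1 - rpf m (i + k), fun i => ?_, ?_, ?_⟩
    · have := rpf_mem m (i + k)
      constructor <;> linarith
    · rw [Finset.sum_sub_distrib, hsum]; simp; ring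
    · simp only [sub_mul, one_mul]
      rw [Finset.sum_sub_distrib, hz, hV]
      have := mul_le_mul_of_nonneg_left h hpos
      linarith

lemma rp_upper (m : ℕ) (hm : 1 ≤ m) (a : ℝ) (ha : a = π / (2 * (2 * m + 1))) (q : ℕ → ℝ)
    (hq : ∀ i < 2 * m + 1, 0 ≤ q i ∧ q i ≤ 1)
    (hsum : ∑ i ∈ Finset.range (2 * m + 1), q i = (2 * m + 1) / 2) :
    ∑ i ∈ Finset.range (2 * m + 1), q i * cos (2 * π * (i + 1) / (2 * m + 1) - (π / 2 + a)) ≤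
      1 / 2 * (cos a / sin a) * cos a := by
  have hm' : (1 : ℝ) ≤ m := by exact_mod_cast hm
  have ha0 : 0 < a := by rw [ha]; positivity
  have ha1 : a < π / 2 := by
    rw [ha]; apply div_lt_div_of_pos_left pi_pos <;> linarith
  have hs : 0 < sin a := sin_pos_of_pos_of_lt_pi ha0 (by linarith [pi_pos])
  have hc : 0 < cos a := cos_pos_of_mem_Ioo ⟨by linarith, ha1⟩
  have hπ : π = (2 * m + 1) * (2 * a) := by rw [ha]; field_simp
  have e : ∀ j : ℕ, 2 * π * (j + 1) / (2 * m + 1) - (π / 2 + a) =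
      (1 - m) * (2 * a) + 2 * j * (2 * a) := by
    intro j; rw [ha]; field_simp; ring
  simp only [e]
  set c : ℕ → ℝ := fun j => cos ((1 - m) * (2 * a) + 2 * j * (2 * a)) with hcdef
  set L : ℝ := cos ((m + 1) * (2 * a)) with hL
  have hLs : L = - sin a := by
    rw [hL, ← cos_add_pi_div_two]; congr 1; rw [hπ]; ring
  have hS : ∑ j ∈ Finset.range m, c j = 1 / (2 * sin a) := by
    have h := rp_sum_cos ((1 - m) * (2 * a)) (2 * a) m
    have e1 : (1 - (m : ℝ)) * (2 * a) + (2 * m - 1) * (2 * a) = π / 2 - a := by rw [hπ]; ring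
    have e2 : (1 - (m : ℝ)) * (2 * a) - 2 * a = -(π / 2 - a) := by rw [hπ]; ring
    rw [e1, e2, sin_neg, sin_pi_div_two_sub, sin_two_mul] at h
    rw [eq_div_iff (by positivity)]
    have : (∑ j ∈ Finset.range m, c j * (2 * sin a)) * (2 * cos a) = 1 * (2 * cos a) := by
      rw [← Finset.sum_mul]; simp only [hcdef]; linarith
    rw [Finset.sum_mul]
    exact mul_right_cancel₀ (by positivity) this
  have hlow : ∀ j < m, L ≤ c j := by
    intro j hj
    have hj' : (j : ℝ) + 1 ≤ m := by exact_mod_cast hj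
    have hj0 : (0 : ℝ) ≤ j := by positivity
    simp only [hcdef, hL]
    rw [← cos_abs ((1 - m) * (2 * a) + 2 * j * (2 * a))]
    apply cos_le_cos_of_nonneg_of_le_pi (abs_nonneg _)
    · rw [hπ]; nlinarith
    · rw [abs_le]; constructor <;> nlinarith
  have hhigh : ∀ j, m ≤ j → j < 2 * m + 1 → c j ≤ L := by
    intro j hj hj2
    have hj' : (m : ℝ) ≤ j := by exact_mod_cast hj
    have hj2' : (j : ℝ) ≤ 2 * m := by exact_mod_cast Nat.lt_succ_iff.1 hj2
    have : c j = - cos (((1 - m) * (2 * a) + 2 * j * (2 * a)) - π) := by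
      rw [cos_sub_pi, neg_neg]
    rw [this]
    have hL2 : L = - cos (π - (m + 1) * (2 * a)) := by rw [cos_pi_sub, neg_neg]
    rw [hL2, neg_le_neg_iff, ← cos_abs ((1 - m) * (2 * a) + 2 * j * (2 * a) - π)]
    apply cos_le_cos_of_nonneg_of_le_pi (abs_nonneg _)
    · nlinarith
    · rw [abs_le, hπ]; constructor <;> nlinarith
  have key : ∑ i ∈ Finset.range (2 * m + 1), q i * (c i - L) ≤
      ∑ i ∈ Finset.range m, (c i - L) := by
    have h : 2 * m + 1 = m + (m + 1) := by ring
    rw [h, Finset.sum_range_add]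
    have h1 : ∑ i ∈ Finset.range m, q i * (c i - L) ≤ ∑ i ∈ Finset.range m, (c i - L) := by
      refine Finset.sum_le_sum fun i hi => ?_
      have hi := Finset.mem_range.1 hi
      have := hlow i hi
      have := hq i (by omega)
      nlinarith
    have h2 : ∑ i ∈ Finset.range (m + 1), q (m + i) * (c (m + i) - L) ≤ 0 := by
      refine Finset.sum_nonpos fun i hi => ?_
      have hi := Finset.mem_range.1 hi
      have := hhigh (m + i) (by omega) (by omega)
      have := hq (m + i) (by omega)
      nlinarith
    linarith
  simp only [mul_sub, Finset.sum_sub_distrib, ← Finset.sum_mul, hsum, hS] at key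
  simp only [Finset.sum_const, Finset.card_range, nsmul_eq_mul, hLs] at key
  have e9 : 1 / 2 * (cos a / sin a) * cos a = 1 / (2 * sin a) - sin a / 2 := by
    have := sin_sq_add_cos_sq a
    field_simp; linarith
  rw [e9]
  linarith

lemma rp_region_eq (n : ℕ) : compatRegion (fun _ => (1 / n : ℝ)) (rotVec n) =
    Set.image (fun q : Fin n → ℝ => ∑ i, (2 * (q i * (1 / n : ℝ))) • rotVec n i)
      (Set.Icc 0 1 ∩ {q | ∑ i, q i * (1 / n : ℝ) = 1 / 2}) := by
  ext x
  simp only [compatRegion, Set.mem_ofPred_eq, Set.mem_image, Set.mem_inter_iff, Set.mem_Icc,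
    Pi.le_def]
  constructor
  · rintro ⟨q, h1, h2, rfl⟩
    exact ⟨q, ⟨⟨fun i => (h1 i).1, fun i => (h1 i).2⟩, h2⟩, rfl⟩
  · rintro ⟨q, ⟨⟨h1, h1'⟩, h2⟩, rfl⟩
    exact ⟨q, fun i => ⟨h1 i, h1' i⟩, h2, rfl⟩

lemma rp_closed (n : ℕ) : IsClosed (compatRegion (fun _ => (1 / n : ℝ)) (rotVec n)) := by
  rw [rp_region_eq]
  apply IsCompact.isClosed
  apply IsCompact.image
  · apply isCompact_Icc.inter_right
    exact isClosed_eq (by fun_prop) (by fun_prop)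
  · fun_prop

lemma rp_convex (n : ℕ) : Convex ℝ (compatRegion (fun _ => (1 / n : ℝ)) (rotVec n)) := by
  rintro x ⟨p, hp, hps, rfl⟩ y ⟨q, hq, hqs, rfl⟩ s t hs ht hst
  refine ⟨fun i => s * p i + t * q i, fun i => ⟨?_, ?_⟩, ?_, ?_⟩
  · have := (hp i).1
    have := (hq i).1
    positivity
  · have := (hp i).2
    have := (hq i).2
    nlinarith
  · have : ∑ i, (s * p i + t * q i) * (1 / n : ℝ) =
      s * ∑ i, p i * (1 / n : ℝ) + t * ∑ i, q i * (1 / n : ℝ) := by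
      rw [Finset.mul_sum, Finset.mul_sum, ← Finset.sum_add_distrib]
      exact Finset.sum_congr rfl fun i _ => by ring
    rw [this, hps, hqs, ← add_mul, hst, one_mul]
  · rw [Finset.smul_sum, Finset.smul_sum, ← Finset.sum_add_distrib]
    refine Finset.sum_congr rfl fun i _ => ?_
    rw [smul_smul, smul_smul, ← add_smul]
    congr 1; ring

/-- Unit vector at angle θ. -/
noncomputable def rpU (θ : ℝ) : EuclideanSpace ℝ (Fin 2) := !₂[cos θ, sin θ]

lemma rpU_norm (θ : ℝ) : ‖rpU θ‖ = 1 := by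
  rw [EuclideanSpace.norm_eq, Fin.sum_univ_two]
  simp [rpU]

lemma rpU_inner_rot (n : ℕ) (θ : ℝ) (i : Fin n) :
    inner ℝ (rpU θ) (rotVec n i) = cos (2 * π * (i.1 + 1) / n - θ) := by
  rw [PiLp.inner_apply, Fin.sum_univ_two, cos_sub]
  simp [rpU, rotVec]

lemma rp_polar (y : EuclideanSpace ℝ (Fin 2)) : ∃ ρ θ : ℝ, 0 ≤ ρ ∧ y = ρ • rpU θ := by
  refine ⟨‖(⟨y 0, y 1⟩ : ℂ)‖, Complex.arg ⟨y 0, y 1⟩, norm_nonneg _, ?_⟩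
  ext i
  fin_cases i
  · simp [rpU, Complex.norm_mul_cos_arg]
  · simp [rpU, Complex.norm_mul_sin_arg]

theorem rot_planar_inradius_odd (n : ℕ) (hn : 3 ≤ n) (hodd : Odd n) :
    (Metric.closedBall (0 : EuclideanSpace ℝ (Fin 2))
        ((1 / n) * (Real.cos (π / (2 * n)) / Real.sin (π / (2 * n))) *
          Real.cos (π / (2 * n))) ⊆
      compatRegion (fun _ => (1 / n : ℝ)) (rotVec n)) ∧
    ∀ r : ℝ,
      (1 / n) * (Real.cos (π / (2 * n)) / Real.sin (π / (2 * n))) *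
          Real.cos (π / (2 * n)) < r →
      ¬ Metric.closedBall (0 : EuclideanSpace ℝ (Fin 2)) r ⊆
          compatRegion (fun _ => (1 / n : ℝ)) (rotVec n) := by
  obtain ⟨m, rfl⟩ := hodd
  have hm : 1 ≤ m := by omega
  have hm' : (1 : ℝ) ≤ m := by exact_mod_cast hm
  have hN : ((2 * m + 1 : ℕ) : ℝ) = 2 * m + 1 := by push_cast; ring
  obtain ⟨a, ha⟩ : ∃ a : ℝ, a = π / (2 * (2 * m + 1)) := ⟨_, rfl⟩
  have hcl := rp_closed (2 * m + 1)
  have hcv := rp_convex (2 * m + 1)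
  have hin := rpU_inner_rot (2 * m + 1)
  have ha0 : 0 < a := by rw [ha]; positivity
  have ha1 : a < π / 2 := by
    rw [ha]; apply div_lt_div_of_pos_left pi_pos <;> linarith
  have hs : 0 < sin a := sin_pos_of_pos_of_lt_pi ha0 (by linarith [pi_pos])
  have hc : 0 < cos a := cos_pos_of_mem_Ioo ⟨by linarith, ha1⟩
  have hinn : ∀ (θ : ℝ) (q : Fin (2 * m + 1) → ℝ),
      inner ℝ (rpU θ) (∑ i, (2 * (q i * (1 / ((2 * m + 1 : ℕ) : ℝ)))) • rotVec (2 * m + 1) i) =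
      2 / (2 * m + 1) * ∑ i, q i * cos (2 * π * (i.1 + 1) / (2 * m + 1) - θ) := by
    intro θ q
    rw [inner_sum, Finset.mul_sum]
    refine Finset.sum_congr rfl fun i _ => ?_
    rw [inner_smul_right, hin, hN]
    ring
  simp only [hN, ← ha] at hcl hcv hinn ⊢
  constructor
  · intro x hx
    by_contra hxm
    obtain ⟨f, u, hf1, hf2⟩ := geometric_hahn_banach_closed_point hcv hcl hxm
    obtain ⟨y, rfl⟩ := (InnerProductSpace.toDual ℝ (EuclideanSpace ℝ (Fin 2))).surjective f
    simp only [InnerProductSpace.toDual_apply_apply] at hf1 hf2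
    obtain ⟨ρ, θ, hρ, rfl⟩ := rp_polar y
    obtain ⟨q, hq, hqs, hqv⟩ := rp_support m hm a θ ha
    have hv := hf1 (∑ i : Fin (2 * m + 1), (2 * (q i * (1 / (2 * m + 1 : ℝ)))) •
      rotVec (2 * m + 1) i) ⟨fun i => q i, fun i => hq i, by
        rw [← Finset.sum_mul, Fin.sum_univ_eq_sum_range (fun i => q i), hqs]
        field_simp, rfl⟩
    rw [inner_smul_left, hinn θ (fun i => q i), Fin.sum_univ_eq_sum_range
      (fun i => q i * cos (2 * π * (i + 1) / (2 * m + 1) - θ))] at hv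
    rw [inner_smul_left] at hf2
    simp only [conj_trivial] at hv hf2
    have hx2 : inner ℝ (rpU θ) x ≤ 1 / (2 * m + 1) * (cos a / sin a) * cos a := by
      refine (real_inner_le_norm _ _).trans ?_
      rw [rpU_norm, one_mul]
      simpa using hx
    have h3 : 1 / (2 * m + 1) * (cos a / sin a) * cos a ≤ 2 / (2 * m + 1) *
        ∑ i ∈ Finset.range (2 * m + 1), q i * cos (2 * π * (i + 1) / (2 * m + 1) - θ) := by
      refine le_trans (le_of_eq ?_) (mul_le_mul_of_nonneg_left hqv (by positivity))
      field_simp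
    have := mul_le_mul_of_nonneg_left (hx2.trans h3) hρ
    linarith
  · intro r hr hsub
    have hr0 : 0 ≤ r := le_trans (by positivity) hr.le
    obtain ⟨q, hq, hqs, hqv⟩ := hsub (show r • rpU (π / 2 + a) ∈ _ by
      simp [norm_smul, rpU_norm, abs_of_nonneg hr0])
    have h1 := congrArg (fun z => inner ℝ (rpU (π / 2 + a)) z) hqv
    simp only at h1
    rw [hinn, inner_smul_right, real_inner_self_eq_norm_sq, rpU_norm] at h1
    set Q : ℕ → ℝ := fun i => if h : i < 2 * m + 1 then q ⟨i, h⟩ else 0 with hQ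
    have hQq : ∀ i : Fin (2 * m + 1), q i = Q i := by
      intro i; simp only [hQ]; rw [dif_pos i.2]
    simp only [hQq] at h1 hqs
    rw [Fin.sum_univ_eq_sum_range
      (fun i => Q i * cos (2 * π * (i + 1) / (2 * m + 1) - (π / 2 + a)))] at h1
    rw [← Finset.sum_mul, Fin.sum_univ_eq_sum_range Q] at hqs
    have hup := rp_upper m hm a ha Q (fun i hi => by rw [← hQq ⟨i, hi⟩]; exact hq _) (by
      field_simp at hqs ⊢; linarith)
    have h2 := mul_le_mul_of_nonneg_left hup (show (0 : ℝ) ≤ 2 / (2 * m + 1) by positivity)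
    have h3 : 2 / (2 * m + 1) * (1 / 2 * (cos a / sin a) * cos a) =
      1 / (2 * m + 1) * (cos a / sin a) * cos a := by field_simp
    linarith
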